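/- Two generalized enveloping algebras (U_{ω₁}(L), φ_{ω₁}) and (U_{ω₂}(L), φ_{ω₂}) of the same color Lie algebra L are isomorphic as Z-filtered, G-graded algebras (compatibly with the structure maps φ) if and only if ω₁ and ω₂ are cohomologous in H²_gr(L,K), i.e., ω₁ − ω₂ is a coboundary. -/

import Mathlib

open TensorAlgebra

/-- An antisymmetric bicharacter `ε : G × G → K` on an abelian group `G`. -/
structure ColorStructure (G K : Type*) [CommGroup G] [Field K] where
  ε : G → G → K
  antisym : ∀ g h, ε g h * ε h g = 1
  mul_right : ∀ g h k, ε g (h * k) = ε g h * ε g k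
  mul_left : ∀ g h k, ε (g * h) k = ε g k * ε h k

/-- A `G`-graded `ε`-Lie algebra (color Lie algebra) structure on a `K`-vector space `V`. -/
structure ColorLieAlgebra {G K : Type*} [CommGroup G] [DecidableEq G] [Field K]
    (χ : ColorStructure G K) (V : Type*) [AddCommGroup V] [Module K V] where
  grading : G → Submodule K V
  decomp : DirectSum.IsInternal grading
  bracket : V →ₗ[K] V →ₗ[K] V
  bracket_grade : ∀ g h : G, ∀ a ∈ grading g, ∀ b ∈ grading h,
    bracket a b ∈ grading (g * h)
  bracket_antisym : ∀ g h : G, ∀ a ∈ grading g, ∀ b ∈ grading h,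
    bracket a b = -(χ.ε g h • bracket b a)
  jacobi : ∀ g h k : G, ∀ a ∈ grading g, ∀ b ∈ grading h, ∀ c ∈ grading k,
    χ.ε k g • bracket a (bracket b c) + χ.ε g h • bracket b (bracket c a)
      + χ.ε h k • bracket c (bracket a b) = 0

/-- A scalar graded 2-cocycle of degree zero on a color Lie algebra,
with values in `K` regarded as a trivial graded `L`-module. -/
structure ColorCocycle {G K : Type*} [CommGroup G] [DecidableEq G] [Field K]
    {χ : ColorStructure G K} {V : Type*} [AddCommGroup V] [Module K V]
    (L : ColorLieAlgebra χ V) where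
  ω : V →ₗ[K] V →ₗ[K] K
  antisym : ∀ g h : G, ∀ a ∈ L.grading g, ∀ b ∈ L.grading h,
    ω a b = -(χ.ε g h * ω b a)
  cocycle : ∀ g h k : G, ∀ a ∈ L.grading g, ∀ b ∈ L.grading h, ∀ c ∈ L.grading k,
    χ.ε k g * ω a (L.bracket b c) + χ.ε g h * ω b (L.bracket c a)
      + χ.ε h k * ω c (L.bracket a b) = 0
  degree_zero : ∀ g h : G, g * h ≠ 1 → ∀ a ∈ L.grading g, ∀ b ∈ L.grading h, ω a b = 0

variable {G K V : Type*} [CommGroup G] [DecidableEq G] [Field K] [AddCommGroup V] [Module K V]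
  {χ : ColorStructure G K}

/-- The defining relations of the generalized enveloping algebra `U_ω(L)`. -/
inductive URel (L : ColorLieAlgebra χ V) (c : ColorCocycle L) :
    TensorAlgebra K V → TensorAlgebra K V → Prop
  | rel {g h : G} {a b : V} (ha : a ∈ L.grading g) (hb : b ∈ L.grading h) :
      URel L c (ι K a * ι K b)
        (χ.ε g h • (ι K b * ι K a) + ι K (L.bracket a b)
          + algebraMap K (TensorAlgebra K V) (c.ω a b))

/-- The generalized enveloping algebra `U_ω(L)`: the quotient of the tensor algebra `T(L)`
by the two-sided ideal generated by the elements
`v₁ ⊗ v₂ - ε(|v₁|,|v₂|) v₂ ⊗ v₁ - [v₁,v₂] - ω(v₁,v₂)` for homogeneous `v₁, v₂`. -/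
def Uenv (L : ColorLieAlgebra χ V) (c : ColorCocycle L) : Type _ :=
  RingQuot (URel L c)

noncomputable instance (L : ColorLieAlgebra χ V) (c : ColorCocycle L) : Ring (Uenv L c) :=
  inferInstanceAs (Ring (RingQuot (URel L c)))

noncomputable instance (L : ColorLieAlgebra χ V) (c : ColorCocycle L) :
    Algebra K (Uenv L c) :=
  inferInstanceAs (Algebra K (RingQuot (URel L c)))

/-- The canonical map `i_ω : L → U_ω(L)`. -/
noncomputable def Uι (L : ColorLieAlgebra χ V) (c : ColorCocycle L) : V →ₗ[K] Uenv L c :=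
  (RingQuot.mkAlgHom K (URel L c)).toLinearMap ∘ₗ ι K

/-- The canonical positive filtration on `U_ω(L)`: `Ufil L c n` is the span of products of
at most `n` images of elements of `L` (the image of `T_n(L)`). -/
noncomputable def Ufil (L : ColorLieAlgebra χ V) (c : ColorCocycle L) (n : ℕ) :
    Submodule K (Uenv L c) :=
  Submodule.span K {u | ∃ l : List V, l.length ≤ n ∧ u = (l.map (Uι L c)).prod}

/-- `Ulow L c n` is `Ufil L c (n-1)`, with the convention `Ufil L c (-1) = ⊥`. -/
noncomputable def Ulow (L : ColorLieAlgebra χ V) (c : ColorCocycle L) :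
    ℕ → Submodule K (Uenv L c)
  | 0 => ⊥
  | n + 1 => Ufil L c n

/-- The `G`-grading of `U_ω(L)`: the `g`-component is spanned by products of images of
homogeneous elements whose degrees multiply to `g`. -/
noncomputable def Ugrading (L : ColorLieAlgebra χ V) (c : ColorCocycle L) (g : G) :
    Submodule K (Uenv L c) :=
  Submodule.span K {u | ∃ l : List (G × V), (∀ p ∈ l, p.2 ∈ L.grading p.1) ∧
    (l.map Prod.fst).prod = g ∧ u = (l.map fun p => Uι L c p.2).prod}

set_option linter.unusedSectionVars false

/-- A `1`-cocycle given on the simple transpositions of a symmetric group is a coboundary in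
characteristic zero. -/
theorem exists_sub_eq_of_braid_cocycle {K M : Type*} [Field K] [CharZero K] [AddCommGroup M]
    [Module K M] (R : ℕ) (s : ℕ → M →ₗ[K] M) (c : ℕ → M)
    (hsq : ∀ i < R, ∀ m, s i (s i m) = m)
    (hcomm : ∀ i j, i + 2 ≤ j → j < R → ∀ m, s i (s j m) = s j (s i m))
    (hbraid : ∀ i, i + 1 < R → ∀ m, s i (s (i + 1) (s i m)) = s (i + 1) (s i (s (i + 1) m)))
    (csq : ∀ i < R, c i + s i (c i) = 0)
    (ccomm : ∀ i j, i + 2 ≤ j → j < R → c j - s i (c j) = c i - s j (c i))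
    (cbraid : ∀ i, i + 1 < R →
      c i + s i (c (i + 1)) + s i (s (i + 1) (c i)) =
        c (i + 1) + s (i + 1) (c i) + s (i + 1) (s i (c (i + 1)))) :
    ∃ f : M, ∀ i < R, f - s i f = c i := by
  induction R generalizing s c with
  | zero => exact ⟨0, by simp⟩
  | succ R ih =>
    obtain ⟨f₀, hf₀⟩ := ih (fun i => s (i + 1)) (fun i => c (i + 1))
      (fun i hi => hsq _ (by omega)) (fun i j h hj => hcomm _ _ (by omega) (by omega))
      (fun i hi => hbraid _ (by omega)) (fun i hi => csq _ (by omega))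
      (fun i j h hj => ccomm _ _ (by omega) (by omega)) (fun i hi => cbraid _ (by omega))
    set d : M := c 0 - (f₀ - s 0 f₀) with hd
    have d_neg : s 0 d = -d := by
      have h1 := csq 0 (by omega)
      have h2 := hsq 0 (by omega) f₀
      simp only [hd, map_sub, h2]
      rw [← sub_eq_zero, ← h1]; abel
    have d_fix : ∀ j, 2 ≤ j → j ≤ R → s j d = d := by
      intro j hj hjR
      have h1 := ccomm 0 j (by omega) (by omega)
      have h2 := hcomm 0 j (by omega) (by omega) f₀
      obtain ⟨j, rfl⟩ : ∃ k, j = k + 1 := ⟨j - 1, by omega⟩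
      have h3 := hf₀ j (by omega)
      rw [← h3] at h1
      simp only [map_sub, h2] at h1
      simp only [hd, map_sub]
      rw [← sub_eq_zero] at h1 ⊢
      rw [← h1]; abel
    have d_braid : 1 ≤ R → s 1 d - s 0 (s 1 d) = d := by
      intro hR
      have h1 := cbraid 0 (by omega)
      have h2 := hbraid 0 (by omega) f₀
      have h3 := hf₀ 0 (by omega)
      simp only [zero_add] at h1 h2 h3
      rw [← h3] at h1
      simp only [map_sub] at h1
      simp only [hd, map_sub, h2]
      rw [← sub_eq_zero] at h1 ⊢
      rw [← neg_eq_zero, ← h1]; abel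
    obtain ⟨p, p_zero, p_succ⟩ : ∃ p : ℕ → M, p 0 = d ∧ ∀ k, p (k + 1) = s (k + 1) (p k) :=
      ⟨fun k => Nat.rec d (fun k m => s (k + 1) m) k, rfl, fun _ => rfl⟩
    have p_fix_gt : ∀ k i, k + 1 < i → i ≤ R → s i (p k) = p k := by
      intro k
      induction k with
      | zero => intro i h1 h2; rw [p_zero]; exact d_fix i (by omega) h2
      | succ k ihk =>
        intro i h1 h2
        rw [p_succ, ← hcomm _ _ (by omega) (by omega), ihk i (by omega) h2]
    have p_fix_lt : ∀ k i, 1 ≤ i → i < k → k ≤ R → s i (p k) = p k := by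
      intro k
      induction k with
      | zero => intro i h1 h2; omega
      | succ k ihk =>
        intro i h1 h2 h3
        rcases Nat.lt_or_ge i k with h | h
        · rw [p_succ, hcomm _ _ (by omega) (by omega), ihk i h1 h (by omega)]
        · obtain rfl : i = k := by omega
          obtain ⟨i, rfl⟩ : ∃ l, i = l + 1 := ⟨i - 1, by omega⟩
          rw [p_succ, p_succ, hbraid _ (by omega), p_fix_gt i (i + 1 + 1) (by omega) (by omega)]
    have p_sub : ∀ k, k + 1 ≤ R → p (k + 1) - s 0 (p (k + 1)) = d := by
      intro k
      induction k with
      | zero => intro h; rw [p_succ, p_zero]; exact d_braid h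
      | succ k ihk =>
        intro h
        rw [p_succ (k + 1), hcomm 0 (k + 1 + 1) (by omega) (by omega), ← map_sub, ihk (by omega),
          d_fix _ (by omega) h]
    set t : M := ∑ k ∈ Finset.range (R + 1), p k with ht
    have t_zero : t - s 0 t = ((R : K) + 2) • d := by
      rw [ht, map_sum, ← Finset.sum_sub_distrib, Finset.sum_range_succ',
        Finset.sum_congr rfl (fun k hk => p_sub k (by have := Finset.mem_range.1 hk; omega)),
        p_zero, d_neg, Finset.sum_const, Finset.card_range, ← Nat.cast_smul_eq_nsmul K]
      module
    have t_fix : ∀ i < R, s (i + 1) t = t := by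
      intro i hi
      rw [ht, map_sum]
      refine Finset.sum_bij' (fun k _ => Equiv.swap i (i + 1) k)
        (fun k _ => Equiv.swap i (i + 1) k) ?_ ?_ ?_ ?_ ?_
      · intro k hk
        simp only [Finset.mem_range, Equiv.swap_apply_def] at hk ⊢
        split_ifs <;> omega
      · intro k hk
        simp only [Finset.mem_range, Equiv.swap_apply_def] at hk ⊢
        split_ifs <;> omega
      · simp
      · simp
      · intro k hk
        have hk := Finset.mem_range.1 hk
        rw [Equiv.swap_apply_def]
        split_ifs with h1 h2
        · rw [h1, p_succ]
        · rw [h2, p_succ, hsq _ (by omega)]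
        · rcases Nat.lt_or_ge k i with h | h
          · exact p_fix_gt _ _ (by omega) (by omega)
          · exact p_fix_lt _ _ (by omega) (by omega) (by omega)
    have hR : (R : K) + 2 ≠ 0 := by
      have : ((R + 2 : ℕ) : K) ≠ 0 := Nat.cast_ne_zero.2 (by omega)
      simpa using this
    refine ⟨f₀ + ((R : K) + 2)⁻¹ • t, fun i hi => ?_⟩
    rcases i with _ | i
    · have : f₀ + ((R : K) + 2)⁻¹ • t - s 0 (f₀ + ((R : K) + 2)⁻¹ • t) =
          f₀ - s 0 f₀ + ((R : K) + 2)⁻¹ • (t - s 0 t) := by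
        rw [map_add, map_smul]; module
      rw [this, t_zero, smul_smul, inv_mul_cancel₀ hR, one_smul, hd]
      abel
    · rw [map_add, map_smul, t_fix i (by omega), ← hf₀ i (by omega)]
      abel

section Words

variable {ι : Type*} (L : ColorLieAlgebra χ V) (c : ColorCocycle L) (b : Module.Basis ι K V)
  (deg : ι → G)

/-- The functional `f ↦ ε(|x|,|y|) f(u y x v)` attached to a word `w = u x y v`, where `u` has
length `i`; it is evaluation at `w` if `w` has no letters in positions `i` and `i + 1`. -/
noncomputable def adjSwapAt (χ : ColorStructure G K) (deg : ι → G) :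
    ℕ → List ι → (List ι → K) →ₗ[K] K
  | 0, x :: y :: v => χ.ε (deg x) (deg y) • LinearMap.proj (y :: x :: v)
  | i + 1, x :: v => adjSwapAt χ deg i v ∘ₗ LinearMap.funLeft K K (x :: ·)
  | _, w => LinearMap.proj w

/-- The functional `f ↦ f(u [x,y] v) + ω(x,y) f(u v)` attached to a word `w = u x y v`, where `u`
has length `i`; it is zero if `w` has no letters in positions `i` and `i + 1`. -/
noncomputable def contractAt : ℕ → List ι → (List ι → K) →ₗ[K] K
  | 0, x :: y :: v =>
      b.constr K (fun k => LinearMap.proj (k :: v)) (L.bracket (b x) (b y)) +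
        c.ω (b x) (b y) • LinearMap.proj v
  | i + 1, x :: v => contractAt i v ∘ₗ LinearMap.funLeft K K (x :: ·)
  | _, _ => 0

/-- A function on words satisfies the defining relations of `U_ω(L)` in length at most `n`. -/
def StraightUpTo (n : ℕ) (f : List ι → K) : Prop :=
  ∀ i w, i + 1 < w.length → w.length ≤ n →
    f w = adjSwapAt χ deg i w f + contractAt L c b i w f

theorem map_fun_constr {X N : Type*} [AddCommGroup N] [Module K N] (Φ : (X → K) →ₗ[K] N)
    (F : ι → X → K) (z : V) :
    Φ (fun v => b.constr K (fun k => F k v) z) = b.constr K (fun k => Φ (F k)) z := by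
  have : (fun v => b.constr K (fun k => F k v) z) = b.constr K F z := by
    funext v
    simp [Module.Basis.constr_apply, Finsupp.sum]
  rw [this, Module.Basis.constr_apply, Module.Basis.constr_apply, Finsupp.sum, Finsupp.sum, map_sum]
  simp

theorem adjSwapAt_zero (x y : ι) (v : List ι) (f : List ι → K) :
    adjSwapAt χ deg 0 (x :: y :: v) f = χ.ε (deg x) (deg y) * f (y :: x :: v) := by
  simp [adjSwapAt]

theorem adjSwapAt_succ (i : ℕ) (x : ι) (v : List ι) (f : List ι → K) :
    adjSwapAt χ deg (i + 1) (x :: v) f = adjSwapAt χ deg i v (fun w => f (x :: w)) := by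
  simp [adjSwapAt, LinearMap.funLeft, Function.comp_def]

theorem contractAt_zero (x y : ι) (v : List ι) (f : List ι → K) :
    contractAt L c b 0 (x :: y :: v) f =
      b.constr K (fun k => f (k :: v)) (L.bracket (b x) (b y)) + c.ω (b x) (b y) * f v := by
  simp [contractAt, Module.Basis.constr_apply, Finsupp.sum]

theorem contractAt_succ (i : ℕ) (x : ι) (v : List ι) (f : List ι → K) :
    contractAt L c b (i + 1) (x :: v) f = contractAt L c b i v (fun w => f (x :: w)) := by
  simp [contractAt, LinearMap.funLeft, Function.comp_def]

theorem adjSwapAt_congr (i : ℕ) (w : List ι) (f g : List ι → K)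
    (h : ∀ w' : List ι, w'.length = w.length → f w' = g w') :
    adjSwapAt χ deg i w f = adjSwapAt χ deg i w g := by
  induction i generalizing w f g with
  | zero =>
    match w with
    | [] => exact h _ rfl
    | [x] => exact h _ rfl
    | x :: y :: v => rw [adjSwapAt_zero, adjSwapAt_zero, h _ (by simp)]
  | succ i ih =>
    match w with
    | [] => exact h _ rfl
    | x :: v =>
      rw [adjSwapAt_succ, adjSwapAt_succ]
      exact ih _ _ _ fun w' hw' => h _ (by simp [hw'])

theorem contractAt_congr (i : ℕ) (w : List ι) (f g : List ι → K)
    (h : ∀ w' : List ι, w'.length < w.length → f w' = g w') :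
    contractAt L c b i w f = contractAt L c b i w g := by
  induction i generalizing w f g with
  | zero =>
    match w with
    | [] => rfl
    | [x] => rfl
    | x :: y :: v =>
      rw [contractAt_zero, contractAt_zero, h v (by simp)]
      congr 3
      funext k
      exact h _ (by simp)
  | succ i ih =>
    match w with
    | [] => rfl
    | x :: v =>
      rw [contractAt_succ, contractAt_succ]
      exact ih _ _ _ fun w' hw' => h _ (by simp [hw'])

theorem StraightUpTo.cons {L : ColorLieAlgebra χ V} {c : ColorCocycle L} {b : Module.Basis ι K V}
    {deg : ι → G} {n : ℕ} {f : List ι → K} (h : StraightUpTo L c b deg (n + 1) f) (x : ι) :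
    StraightUpTo L c b deg n (fun w => f (x :: w)) := by
  intro i w hi hw
  rw [← adjSwapAt_succ, ← contractAt_succ]
  exact h (i + 1) (x :: w) (by simpa using hi) (by simpa using hw)

theorem adjSwapAt_adjSwapAt_self (i : ℕ) (w : List ι) (f : List ι → K) (hi : i + 1 < w.length) :
    adjSwapAt χ deg i w (fun w' => adjSwapAt χ deg i w' f) = f w := by
  induction i generalizing w f with
  | zero =>
    match w with
    | [] => simp at hi
    | [x] => simp at hi
    | x :: y :: v =>
      rw [adjSwapAt_zero, adjSwapAt_zero, ← mul_assoc, χ.antisym, one_mul]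
  | succ i ih =>
    match w with
    | [] => simp at hi
    | x :: v =>
      rw [adjSwapAt_succ]
      simp only [adjSwapAt_succ]
      exact ih _ _ (by simpa using hi)

theorem adjSwapAt_comm (i j : ℕ) (w : List ι) (f : List ι → K) (hij : i + 2 ≤ j)
    (hj : j + 1 < w.length) :
    adjSwapAt χ deg i w (fun w' => adjSwapAt χ deg j w' f) =
      adjSwapAt χ deg j w (fun w' => adjSwapAt χ deg i w' f) := by
  induction i generalizing j w f with
  | zero =>
    obtain ⟨d, rfl⟩ : ∃ d, j = d + 2 := ⟨j - 2, by omega⟩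
    match w with
    | [] => simp at hj
    | [x] => simp at hj
    | x :: y :: v =>
      simp only [adjSwapAt_zero, adjSwapAt_succ]
      exact (map_smul (adjSwapAt χ deg d v) (χ.ε (deg x) (deg y))
        (fun w' => f (y :: x :: w'))).symm
  | succ i ih =>
    obtain ⟨j, rfl⟩ : ∃ d, j = d + 1 := ⟨j - 1, by omega⟩
    match w with
    | [] => simp at hj
    | x :: v =>
      simp only [adjSwapAt_succ]
      exact ih _ _ _ (by omega) (by simpa using hj)

theorem adjSwapAt_braid (i : ℕ) (w : List ι) (f : List ι → K) (hi : i + 2 < w.length) :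
    adjSwapAt χ deg i w (fun w' => adjSwapAt χ deg (i + 1) w' (fun w'' => adjSwapAt χ deg i w'' f)) =
      adjSwapAt χ deg (i + 1) w
        (fun w' => adjSwapAt χ deg i w' (fun w'' => adjSwapAt χ deg (i + 1) w'' f)) := by
  induction i generalizing w f with
  | zero =>
    match w with
    | [] => simp at hi
    | [x] => simp at hi
    | [x, y] => simp at hi
    | x :: y :: z :: v =>
      simp only [adjSwapAt_zero, adjSwapAt_succ]
      ring
  | succ i ih =>
    match w with
    | [] => simp at hi
    | x :: v =>
      simp only [adjSwapAt_succ]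
      exact ih _ _ (by simp at hi; omega)

theorem contractAt_antisymm (hb : ∀ k, b k ∈ L.grading (deg k)) (i : ℕ) (w : List ι)
    (f : List ι → K) (hi : i + 1 < w.length) :
    contractAt L c b i w f + adjSwapAt χ deg i w (fun w' => contractAt L c b i w' f) = 0 := by
  induction i generalizing w f with
  | zero =>
    match w with
    | [] => simp at hi
    | [x] => simp at hi
    | x :: y :: v =>
      rw [adjSwapAt_zero, contractAt_zero, contractAt_zero, c.antisym _ _ _ (hb x) _ (hb y),
        L.bracket_antisym _ _ _ (hb x) _ (hb y), map_neg, map_smul, smul_eq_mul]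
      ring
  | succ i ih =>
    match w with
    | [] => simp at hi
    | x :: v =>
      simp only [adjSwapAt_succ, contractAt_succ]
      exact ih _ _ (by simpa using hi)

theorem contractAt_comm (i j : ℕ) (w : List ι) (f : List ι → K) (hij : i + 2 ≤ j)
    (hj : j + 1 < w.length) (n : ℕ) (hw : w.length ≤ n + 1) (hf : StraightUpTo L c b deg n f) :
    contractAt L c b j w f - adjSwapAt χ deg i w (fun w' => contractAt L c b j w' f) =
      contractAt L c b i w f - adjSwapAt χ deg j w (fun w' => contractAt L c b i w' f) := by
  induction i generalizing j w f n with
  | zero =>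
    obtain ⟨d, rfl⟩ : ∃ d, j = d + 2 := ⟨j - 2, by omega⟩
    match w with
    | [] => simp at hj
    | [x] => simp at hj
    | x :: y :: v =>
      simp only [List.length_cons] at hj hw
      simp only [adjSwapAt_zero, adjSwapAt_succ, contractAt_succ, contractAt_zero]
      set z := L.bracket (b x) (b y)
      set o := c.ω (b x) (b y)
      have lin : ∀ Φ : (List ι → K) →ₗ[K] K,
          Φ (fun v' => b.constr K (fun k => f (k :: v')) z + o * f v') =
            b.constr K (fun k => Φ (fun v' => f (k :: v'))) z + o * Φ f := by
        intro Φ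
        rw [← map_fun_constr, ← smul_eq_mul, ← map_smul, ← map_add]
        rfl
      have h1 : contractAt L c b d v (fun w' => f (x :: y :: w')) -
          χ.ε (deg x) (deg y) * contractAt L c b d v (fun w' => f (y :: x :: w')) =
          contractAt L c b d v (fun v' => b.constr K (fun k => f (k :: v')) z + o * f v') := by
        rw [← smul_eq_mul, ← map_smul, ← map_sub]
        refine contractAt_congr L c b _ _ _ _ fun v' hv' => ?_
        have := hf 0 (x :: y :: v') (by simp) (by simp; omega)
        rw [adjSwapAt_zero, contractAt_zero] at this
        simp only [Pi.sub_apply, Pi.smul_apply, smul_eq_mul, this]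
        ring
      rw [h1, lin, lin]
      have h2 : (fun k => contractAt L c b d v (fun v' => f (k :: v'))) =
          (fun k => f (k :: v)) - fun k => adjSwapAt χ deg d v (fun v' => f (k :: v')) := by
        funext k
        have := hf (d + 1) (k :: v) (by simp; omega) (by simp; omega)
        rw [adjSwapAt_succ, contractAt_succ] at this
        simp only [Pi.sub_apply, this]
        ring
      have h3 := hf d v (by omega) (by omega)
      rw [h2, map_sub, LinearMap.sub_apply]
      linear_combination -o * h3
  | succ i ih =>
    obtain ⟨j, rfl⟩ : ∃ d, j = d + 1 := ⟨j - 1, by omega⟩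
    match w, n with
    | [], _ => simp at hj
    | x :: v, 0 => simp at hj hw; simp [hw] at hj
    | x :: v, n + 1 =>
      simp only [adjSwapAt_succ, contractAt_succ]
      exact ih _ _ _ (by omega) (by simpa using hj) n (by simpa using hw) (hf.cons x)

theorem ColorStructure.ε_one_left (χ : ColorStructure G K) (h : G) : χ.ε 1 h = 1 := by
  have h1 := χ.mul_left 1 1 h
  have h2 : χ.ε 1 h ≠ 0 := left_ne_zero_of_mul_eq_one (χ.antisym 1 h)
  rw [mul_one] at h1
  exact mul_left_cancel₀ h2 (by rw [← h1, mul_one])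

theorem StraightUpTo.constr_cons_sub {L : ColorLieAlgebra χ V} {c : ColorCocycle L}
    {b : Module.Basis ι K V} {deg : ι → G} {n : ℕ} {f : List ι → K}
    (hspan : ∀ g, L.grading g ≤ Submodule.span K (b '' {k | deg k = g}))
    (hf : StraightUpTo L c b deg n f) {g : G} {a : V} (ha : a ∈ L.grading g) (z : ι) (v : List ι)
    (hv : v.length + 2 ≤ n) :
    b.constr K (fun k => f (k :: z :: v)) a -
        χ.ε g (deg z) * b.constr K (fun k => f (z :: k :: v)) a =
      b.constr K (fun k => f (k :: v)) (L.bracket a (b z)) + c.ω a (b z) * f v := by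
  refine Submodule.span_induction (p := fun a _ => b.constr K (fun k => f (k :: z :: v)) a -
        χ.ε g (deg z) * b.constr K (fun k => f (z :: k :: v)) a =
      b.constr K (fun k => f (k :: v)) (L.bracket a (b z)) + c.ω a (b z) * f v)
    ?_ ?_ ?_ ?_ (hspan g ha)
  · rintro _ ⟨k, rfl, rfl⟩
    have := hf 0 (k :: z :: v) (by simp) (by simp; omega)
    rw [adjSwapAt_zero, contractAt_zero] at this
    rw [b.constr_basis, b.constr_basis, this]
    ring
  · simp
  · intro p q _ _ hp hq
    simp only [map_add, LinearMap.add_apply]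
    linear_combination hp + hq
  · intro r p _ hp
    simp only [map_smul, LinearMap.smul_apply, smul_eq_mul]
    linear_combination r * hp

theorem ColorCocycle.mul_one_sub_eq_zero {L : ColorLieAlgebra χ V} (c : ColorCocycle L) {g h : G}
    {x y : V} (hx : x ∈ L.grading g) (hy : y ∈ L.grading h) (k : G) :
    c.ω x y * (1 - χ.ε g k * χ.ε h k) = 0 := by
  by_cases hgh : g * h = 1
  · rw [← χ.mul_left, hgh, χ.ε_one_left, sub_self, mul_zero]
  · rw [c.degree_zero g h hgh x hx y hy, zero_mul]

theorem contractAt_braid (hb : ∀ k, b k ∈ L.grading (deg k))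
    (hspan : ∀ g, L.grading g ≤ Submodule.span K (b '' {k | deg k = g}))
    (i : ℕ) (w : List ι) (f : List ι → K)
    (hi : i + 2 < w.length) (n : ℕ) (hw : w.length ≤ n + 1) (hf : StraightUpTo L c b deg n f) :
    contractAt L c b i w f + adjSwapAt χ deg i w (fun w' => contractAt L c b (i + 1) w' f) +
        adjSwapAt χ deg i w
          (fun w' => adjSwapAt χ deg (i + 1) w' (fun w'' => contractAt L c b i w'' f)) =
      contractAt L c b (i + 1) w f + adjSwapAt χ deg (i + 1) w (fun w' => contractAt L c b i w' f) +
        adjSwapAt χ deg (i + 1) w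
          (fun w' => adjSwapAt χ deg i w' (fun w'' => contractAt L c b (i + 1) w'' f)) := by
  induction i generalizing w f n with
  | zero =>
    match w with
    | [] => simp at hi
    | [x] => simp at hi
    | [x, y] => simp at hi
    | x :: y :: z :: v =>
      simp only [List.length_cons] at hw
      simp only [adjSwapAt_zero, adjSwapAt_succ, contractAt_succ, contractAt_zero]
      have hx := hb x
      have hy := hb y
      have hz := hb z
      have kxy := hf.constr_cons_sub hspan (L.bracket_grade _ _ _ hx _ hy) z v (by omega)
      have kyz := hf.constr_cons_sub hspan (L.bracket_grade _ _ _ hy _ hz) x v (by omega)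
      have kxz := hf.constr_cons_sub hspan (L.bracket_grade _ _ _ hx _ hz) y v (by omega)
      have oxy := c.mul_one_sub_eq_zero hx hy (deg z)
      have oyz := c.mul_one_sub_eq_zero hy hz (deg x)
      have oxz := c.mul_one_sub_eq_zero hx hz (deg y)
      rw [χ.mul_left] at kxy kyz kxz
      have jac := congrArg (b.constr K (fun k => f (k :: v))) (L.jacobi _ _ _ _ hx _ hy _ hz)
      have coc := c.cocycle _ _ _ _ hx _ hy _ hz
      rw [L.bracket_antisym _ _ _ hx _ (L.bracket_grade _ _ _ hy _ hz),
        L.bracket_antisym _ _ _ hy _ (L.bracket_grade _ _ _ hz _ hx),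
        L.bracket_antisym _ _ _ hz _ (L.bracket_grade _ _ _ hx _ hy),
        L.bracket_antisym _ _ _ hz _ hx] at jac
      rw [c.antisym _ _ _ hx _ (L.bracket_grade _ _ _ hy _ hz),
        c.antisym _ _ _ hy _ (L.bracket_grade _ _ _ hz _ hx),
        c.antisym _ _ _ hz _ (L.bracket_grade _ _ _ hx _ hy),
        L.bracket_antisym _ _ _ hz _ hx] at coc
      simp only [map_neg, map_smul, map_add, map_zero, LinearMap.neg_apply, LinearMap.smul_apply,
        smul_eq_mul, χ.mul_right] at jac coc
      have hxy := χ.antisym (deg x) (deg y)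
      have hyz := χ.antisym (deg y) (deg z)
      have hxz := χ.antisym (deg x) (deg z)
      set β := b.constr K (fun k => f (k :: v))
      generalize χ.ε (deg x) (deg y) = exy at *
      generalize χ.ε (deg y) (deg x) = eyx at *
      generalize χ.ε (deg x) (deg z) = exz at *
      generalize χ.ε (deg z) (deg x) = ezx at *
      generalize χ.ε (deg y) (deg z) = eyz at *
      generalize χ.ε (deg z) (deg y) = ezy at *
      generalize β (L.bracket (L.bracket (b x) (b y)) (b z)) = J1 at *
      generalize β (L.bracket (L.bracket (b y) (b z)) (b x)) = J2 at *
      generalize β (L.bracket (L.bracket (b x) (b z)) (b y)) = J3 at *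
      generalize c.ω (L.bracket (b x) (b y)) (b z) = w1 at *
      generalize c.ω (L.bracket (b y) (b z)) (b x) = w2 at *
      generalize c.ω (L.bracket (b x) (b z)) (b y) = w3 at *
      have jac' : J1 + exy * exz * J2 - eyz * J3 = 0 := by
        linear_combination -exz * jac - exy * exz * J2 * hxz
          + eyz * J3 * (exz * ezx * hxy + hxz) - J1 * (eyz * ezy * hxz + hyz)
      have coc' : w1 + exy * exz * w2 - eyz * w3 = 0 := by
        linear_combination -exz * coc - exy * exz * w2 * hxz
          + eyz * w3 * (exz * ezx * hxy + hxz) - w1 * (eyz * ezy * hxz + hyz)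
      generalize b.constr K (fun k => f (x :: k :: v)) (L.bracket (b y) (b z)) = B' at *
      generalize b.constr K (fun k => f (y :: k :: v)) (L.bracket (b x) (b z)) = C' at *
      linear_combination kxy + exy * exz * kyz - eyz * kxz + jac' + f v * coc'
        + B' * (exz * ezx * hxy + hxz) - C' * exy * hyz + f (z :: v) * oxy
        - f (y :: v) * eyz * oxz - c.ω (b x) (b z) * exy * f (y :: v) * hyz
        + f (x :: v) * exy * exz * oyz + c.ω (b y) (b z) * f (x :: v) * (exz * ezx * hxy + hxz)
  | succ i ih =>
    match w, n with
    | [], _ => simp at hi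
    | x :: v, 0 => simp at hi hw; simp [hw] at hi
    | x :: v, n + 1 =>
      simp only [adjSwapAt_succ, contractAt_succ]
      exact ih _ _ (by simp at hi; omega) n (by simpa using hw) (hf.cons x)

theorem StraightUpTo.exists_extend [CharZero K] (hb : ∀ k, b k ∈ L.grading (deg k))
    (hspan : ∀ g, L.grading g ≤ Submodule.span K (b '' {k | deg k = g})) (n : ℕ) (f : List ι → K)
    (hf : StraightUpTo L c b deg n f) :
    ∃ f', StraightUpTo L c b deg (n + 1) f' ∧ ∀ w, w.length ≤ n → f' w = f w := by
  classical
  let s : ℕ → (List ι → K) →ₗ[K] (List ι → K) := fun i => LinearMap.pi fun w =>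
    if w.length = n + 1 then adjSwapAt χ deg i w else LinearMap.proj w
  let d : ℕ → List ι → K := fun i w => if w.length = n + 1 then contractAt L c b i w f else 0
  have s_ne : ∀ i w m, w.length ≠ n + 1 → s i m w = m w := fun i w m h => by simp [s, h]
  have s_eq : ∀ i w m, w.length = n + 1 → s i m w = adjSwapAt χ deg i w m :=
    fun i w m h => by simp [s, h]
  have d_ne : ∀ i w, w.length ≠ n + 1 → d i w = 0 := fun i w h => by simp [d, h]
  have d_eq : ∀ i w, w.length = n + 1 → d i w = contractAt L c b i w f :=
    fun i w h => by simp [d, h]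
  have s_comp : ∀ i w m m', w.length = n + 1 → (∀ w' : List ι, w'.length = n + 1 → m w' = m' w') →
      s i m w = adjSwapAt χ deg i w m' := fun i w m m' h hm => by
    rw [s_eq _ _ _ h]
    exact adjSwapAt_congr _ _ _ _ _ fun w' hw' => hm _ (hw'.trans h)
  suffices key : ∃ h : List ι → K, ∀ i < n, h - s i h = d i by
    obtain ⟨h, hh⟩ := key
    let f' : List ι → K := fun w => if w.length = n + 1 then h w else f w
    have f'_of_ne : ∀ w : List ι, w.length ≠ n + 1 → f' w = f w := fun w hw => by simp [f', hw]
    have f'_of_eq : ∀ w : List ι, w.length = n + 1 → f' w = h w := fun w hw => by simp [f', hw]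
    refine ⟨f', fun i w hi hw => ?_, fun w hw => f'_of_ne w (by omega)⟩
    have hc : contractAt L c b i w f' = contractAt L c b i w f :=
      contractAt_congr _ _ _ _ _ _ _ fun w' hw' => f'_of_ne w' (by omega)
    rw [hc]
    by_cases hwn : w.length = n + 1
    · have := congrFun (hh i (by omega)) w
      rw [d_eq _ _ hwn, Pi.sub_apply, s_eq _ _ _ hwn] at this
      rw [f'_of_eq w hwn, ← this, adjSwapAt_congr deg i w f' h fun w' hw' => f'_of_eq w' (by omega)]
      ring
    · rw [f'_of_ne w hwn, adjSwapAt_congr deg i w f' f fun w' hw' => f'_of_ne w' (by omega)]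
      exact hf i w hi (by omega)
  refine exists_sub_eq_of_braid_cocycle (K := K) n s d ?_ ?_ ?_ ?_ ?_ ?_
  · intro i hi m
    funext w
    by_cases hw : w.length = n + 1
    · rw [s_comp _ _ _ _ hw fun w' hw' => s_eq _ _ _ hw',
        adjSwapAt_adjSwapAt_self _ _ _ _ (by omega)]
    · rw [s_ne _ _ _ hw, s_ne _ _ _ hw]
  · intro i j hij hj m
    funext w
    by_cases hw : w.length = n + 1
    · rw [s_comp _ _ _ _ hw fun w' hw' => s_eq _ _ _ hw',
        s_comp _ _ _ _ hw fun w' hw' => s_eq _ _ _ hw', adjSwapAt_comm _ _ _ _ _ hij (by omega)]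
    · simp only [s_ne _ _ _ hw]
  · intro i hi m
    funext w
    by_cases hw : w.length = n + 1
    · rw [s_comp _ _ _ _ hw fun w' hw' => s_comp _ _ _ _ hw' fun w' hw' => s_eq _ _ _ hw',
        s_comp _ _ _ _ hw fun w' hw' => s_comp _ _ _ _ hw' fun w' hw' => s_eq _ _ _ hw',
        adjSwapAt_braid _ _ _ _ (by omega)]
    · simp only [s_ne _ _ _ hw]
  · intro i hi
    funext w
    by_cases hw : w.length = n + 1
    · rw [Pi.add_apply, s_comp _ _ _ _ hw fun w' hw' => d_eq _ _ hw', d_eq _ _ hw]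
      exact contractAt_antisymm L c b deg hb _ _ _ (by omega)
    · simp [s_ne _ _ _ hw, d_ne _ _ hw]
  · intro i j hij hj
    funext w
    by_cases hw : w.length = n + 1
    · rw [Pi.sub_apply, Pi.sub_apply, s_comp _ _ _ _ hw fun w' hw' => d_eq _ _ hw',
        s_comp _ _ _ _ hw fun w' hw' => d_eq _ _ hw', d_eq _ _ hw, d_eq _ _ hw]
      exact contractAt_comm L c b deg _ _ _ _ hij (by omega) n (by omega) hf
    · simp [s_ne _ _ _ hw, d_ne _ _ hw]
  · intro i hi
    funext w
    by_cases hw : w.length = n + 1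
    · simp only [Pi.add_apply]
      rw [s_comp _ _ _ _ hw fun w' hw' => d_eq _ _ hw',
        s_comp _ _ _ _ hw fun w' hw' => d_eq _ _ hw',
        s_comp _ _ _ _ hw fun w' hw' => s_comp _ _ _ _ hw' fun w' hw' => d_eq _ _ hw',
        s_comp _ _ _ _ hw fun w' hw' => s_comp _ _ _ _ hw' fun w' hw' => d_eq _ _ hw',
        d_eq _ _ hw, d_eq _ _ hw]
      exact contractAt_braid L c b deg hb hspan _ _ _ (by omega) n (by omega) hf
    · simp [s_ne _ _ _ hw, d_ne _ _ hw]

theorem exists_forall_straightUpTo [CharZero K] (hb : ∀ k, b k ∈ L.grading (deg k))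
    (hspan : ∀ g, L.grading g ≤ Submodule.span K (b '' {k | deg k = g})) :
    ∃ f : List ι → K, f [] = 1 ∧ ∀ n, StraightUpTo L c b deg n f := by
  choose! E hE hE' using StraightUpTo.exists_extend L c b deg hb hspan
  let F : ℕ → List ι → K := fun n => Nat.rec (fun _ => 1) (fun n f => E n f) n
  have hF : ∀ n, StraightUpTo L c b deg n (F n) := by
    intro n
    induction n with
    | zero => intro i w h1 h2; omega
    | succ n ih => exact hE n _ ih
  have hF' : ∀ (w : List ι) n, w.length ≤ n → F n w = F w.length w := by
    intro w n hn
    induction n, hn using Nat.le_induction with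
    | base => rfl
    | succ n hn ih => exact (hE' n _ (hF n) w hn).trans ih
  refine ⟨fun w => F w.length w, rfl, fun _ i w hi _ => ?_⟩
  refine (hF w.length i w hi le_rfl).trans (congrArg₂ (· + ·) ?_ ?_)
  · exact adjSwapAt_congr _ _ _ _ _ fun w' hw' => by rw [hw']
  · exact contractAt_congr _ _ _ _ _ _ _ fun w' hw' => hF' _ _ hw'.le

theorem straight_append {L : ColorLieAlgebra χ V} {c : ColorCocycle L} {b : Module.Basis ι K V}
    {deg : ι → G} {f : List ι → K} (hf : ∀ n, StraightUpTo L c b deg n f) (u v : List ι)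
    (x y : ι) :
    f (u ++ x :: y :: v) = χ.ε (deg x) (deg y) * f (u ++ y :: x :: v) +
      (b.constr K (fun k => f (u ++ k :: v)) (L.bracket (b x) (b y)) +
        c.ω (b x) (b y) * f (u ++ v)) := by
  induction u generalizing f with
  | nil =>
    have := hf _ 0 (x :: y :: v) (by simp) le_rfl
    rwa [contractAt_zero, adjSwapAt_zero] at this
  | cons t u ih => exact ih (f := fun w => f (t :: w)) fun n => (hf (n + 1)).cons t

theorem Module.Basis.tensorAlgebra_ofList (l : List ι) :
    b.tensorAlgebra (FreeMonoid.ofList l) = (l.map fun k => TensorAlgebra.ι K (b k)).prod := by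
  have h : FreeAlgebra.basisFreeMonoid K ι (FreeMonoid.ofList l) =
      (l.map (FreeAlgebra.ι K)).prod := by
    simp [FreeAlgebra.basisFreeMonoid, FreeAlgebra.equivMonoidAlgebraFreeMonoid,
      FreeMonoid.lift_apply]
  rw [Module.Basis.tensorAlgebra, Module.Basis.map_apply, h]
  simp [map_list_prod, List.map_map, Function.comp_def]

/-- The functional on the tensor algebra given by a function on words satisfying the defining
relations of `U_ω(L)` kills the ideal generated by these relations. -/
theorem tensorAlgebra_functional_rel {L : ColorLieAlgebra χ V} {c : ColorCocycle L}
    {b : Module.Basis ι K V} {deg : ι → G}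
    (hspan : ∀ g, L.grading g ≤ Submodule.span K (b '' {k | deg k = g}))
    {f : List ι → K} (hf : ∀ n, StraightUpTo L c b deg n f) {l : TensorAlgebra K V →ₗ[K] K}
    (hl : ∀ u, l ((u.map fun k => TensorAlgebra.ι K (b k)).prod) = f u)
    {s t : TensorAlgebra K V} (hst : URel L c s t) (p q : TensorAlgebra K V) :
    l (p * s * q) = l (p * t * q) := by
  have span_top : ∀ p : TensorAlgebra K V, p ∈ Submodule.span K
      (Set.range fun u : List ι => (u.map fun k => TensorAlgebra.ι K (b k)).prod) := fun p => by
    have := b.tensorAlgebra.mem_span p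
    rwa [show Set.range b.tensorAlgebra = Set.range fun u : List ι =>
      (u.map fun k => TensorAlgebra.ι K (b k)).prod from ?_] at this
    ext t
    exact ⟨fun ⟨u, hu⟩ => ⟨u.toList, (b.tensorAlgebra_ofList u.toList).symm.trans hu⟩,
      fun ⟨u, hu⟩ => ⟨FreeMonoid.ofList u, (b.tensorAlgebra_ofList u).trans hu⟩⟩
  induction span_top p using Submodule.span_induction with
  | zero => simp
  | add p p' _ _ hp hp' => simp only [add_mul, map_add, hp, hp']
  | smul r p _ hp => simp only [smul_mul_assoc, map_smul, hp]
  | mem p hp =>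
  obtain ⟨u, rfl⟩ := hp
  induction span_top q using Submodule.span_induction with
  | zero => simp
  | add q q' _ _ hq hq' => simp only [mul_add, map_add, hq, hq']
  | smul r q _ hq => simp only [mul_smul_comm, map_smul, hq]
  | mem q hq =>
  obtain ⟨v, rfl⟩ := hq
  obtain @⟨g, h, x, y, hx, hy⟩ := hst
  have one_slot : ∀ z, l ((u.map fun k => TensorAlgebra.ι K (b k)).prod * TensorAlgebra.ι K z *
      (v.map fun k => TensorAlgebra.ι K (b k)).prod) =
        b.constr K (fun k => f (u ++ k :: v)) z := by
    intro z
    have : l ∘ₗ LinearMap.mulRight K (v.map fun k => TensorAlgebra.ι K (b k)).prod ∘ₗ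
        LinearMap.mulLeft K (u.map fun k => TensorAlgebra.ι K (b k)).prod ∘ₗ TensorAlgebra.ι K =
        b.constr K (fun k => f (u ++ k :: v)) := by
      refine b.ext fun k => ?_
      rw [b.constr_basis, ← hl]
      simp [mul_assoc]
    exact LinearMap.congr_fun this z
  replace hx := hspan g hx
  induction hx using Submodule.span_induction with
  | zero => simp
  | add x x' _ _ h1 h2 =>
    simp only [mul_add, add_mul, map_add, LinearMap.add_apply, smul_add] at h1 h2 ⊢
    rw [h1, h2]; ring
  | smul r x _ h1 =>
    simp only [mul_add, add_mul, map_add, LinearMap.smul_apply, map_smul, smul_mul_assoc,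
      mul_smul_comm, smul_eq_mul, Algebra.algebraMap_eq_smul_one, mul_one] at h1 ⊢
    rw [h1]; ring
  | mem x hx' =>
  obtain ⟨i, rfl, rfl⟩ := hx'
  replace hy := hspan h hy
  induction hy using Submodule.span_induction with
  | zero => simp
  | add x x' _ _ h1 h2 =>
    simp only [mul_add, add_mul, map_add, smul_add] at h1 h2 ⊢
    rw [h1, h2]; ring
  | smul r x _ h1 =>
    simp only [mul_add, add_mul, map_add, map_smul, smul_mul_assoc,
      mul_smul_comm, smul_eq_mul, Algebra.algebraMap_eq_smul_one, mul_one] at h1 ⊢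
    rw [h1]; ring
  | mem x hx' =>
  obtain ⟨j, rfl, rfl⟩ := hx'
  have two_slot : ∀ i j, l ((u.map fun k => TensorAlgebra.ι K (b k)).prod *
      (TensorAlgebra.ι K (b i) * TensorAlgebra.ι K (b j)) *
      (v.map fun k => TensorAlgebra.ι K (b k)).prod) = f (u ++ i :: j :: v) := by
    intro i j
    rw [← hl]
    simp [mul_assoc]
  have no_slot : l ((u.map fun k => TensorAlgebra.ι K (b k)).prod *
      (v.map fun k => TensorAlgebra.ι K (b k)).prod) = f (u ++ v) := by
    rw [← hl]
    simp
  simp only [Algebra.algebraMap_eq_smul_one, mul_add, add_mul, map_add, mul_smul_comm,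
    smul_mul_assoc, mul_one, map_smul, two_slot, one_slot, no_slot, smul_eq_mul]
  rw [straight_append hf u v i j]
  ring

end Words

theorem Uenv_nontrivial [CharZero K] (L : ColorLieAlgebra χ V) (c : ColorCocycle L) :
    Nontrivial (Uenv L c) := by
  let v := fun g => Module.Basis.ofVectorSpace K (L.grading g)
  let b := L.decomp.collectedBasis v
  have hb : ∀ k, b k ∈ L.grading k.1 := fun k => L.decomp.collectedBasis_mem v k
  have hspan : ∀ g, L.grading g ≤ Submodule.span K (b '' {k | k.1 = g}) := by
    intro g x hx
    rw [Module.Basis.mem_span_image]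
    rintro ⟨h, k⟩ hk
    by_contra hne
    have hne : g ≠ h := fun e => hne e.symm
    exact Finsupp.mem_support_iff.1 hk
      (L.decomp.collectedBasis_repr_of_mem_ne v hne hx)
  obtain ⟨f, hf1, hf⟩ := exists_forall_straightUpTo L c b Sigma.fst hb hspan
  let l := b.tensorAlgebra.constr K (fun w => f w.toList)
  have hl : ∀ u, l ((u.map fun k => TensorAlgebra.ι K (b k)).prod) = f u := fun u => by
    rw [← b.tensorAlgebra_ofList, Module.Basis.constr_basis]
    rfl
  let r : RingCon (TensorAlgebra K V) :=
    { r := fun s t => ∀ p q, l (p * s * q) = l (p * t * q)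
      iseqv := ⟨fun _ _ _ => rfl, fun h p q => (h p q).symm,
        fun h h' p q => (h p q).trans (h' p q)⟩
      add' := fun {s t s' t'} h h' p q => by
        simp only [mul_add, add_mul, map_add, h p q, h' p q]
      mul' := fun {s t s' t'} h h' p q => by
        have h1 := h p (s' * q)
        have h2 := h' (p * t) q
        simp only [mul_assoc] at h1 h2 ⊢
        rw [h1, h2] }
  have hr : ∀ s t, r s t ↔ ∀ p q, l (p * s * q) = l (p * t * q) := fun _ _ => Iff.rfl
  have hrel : ∀ ⦃s t⦄, URel L c s t → r.mk' s = r.mk' t := fun s t h =>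
    (RingCon.eq r).2 fun p q => tensorAlgebra_functional_rel hspan hf hl h p q
  let F : Uenv L c →+* r.Quotient := RingQuot.lift ⟨r.mk', hrel⟩
  refine ⟨⟨0, 1, fun h => ?_⟩⟩
  have h := congrArg F h
  rw [map_zero, map_one] at h
  have h := (RingCon.eq r).1 (h : ((0 : TensorAlgebra K V) : r.Quotient) = (1 : TensorAlgebra K V))
  have h := h 1 1
  have h1 := hl []
  simp only [List.map_nil, List.prod_nil] at h1
  simp [h1, hf1] at h

theorem ColorStructure.ε_one_right (χ : ColorStructure G K) (g : G) : χ.ε g 1 = 1 := by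
  have h := χ.antisym g 1
  rwa [χ.ε_one_left, mul_one] at h

section Hom

variable {L : ColorLieAlgebra χ V} {c c₁ c₂ : ColorCocycle L}

theorem Uι_mul_Uι {g h : G} {a b : V} (ha : a ∈ L.grading g) (hb : b ∈ L.grading h) :
    Uι L c a * Uι L c b = χ.ε g h • (Uι L c b * Uι L c a) + Uι L c (L.bracket a b) +
      algebraMap K (Uenv L c) (c.ω a b) := by
  have h := RingQuot.mkAlgHom_rel K (URel.rel (c := c) ha hb)
  simp only [map_add, map_mul, map_smul, AlgHom.commutes] at h
  exact h

/-- Linear maps out of `L` respecting the defining relations extend to `U_ω(L)`. -/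
noncomputable def Ulift {A : Type*} [Ring A] [Algebra K A] (φ : V →ₗ[K] A)
    (hφ : ∀ (g h : G) (a b : V), a ∈ L.grading g → b ∈ L.grading h →
      φ a * φ b = χ.ε g h • (φ b * φ a) + φ (L.bracket a b) + algebraMap K A (c.ω a b)) :
    Uenv L c →ₐ[K] A :=
  RingQuot.liftAlgHom K ⟨TensorAlgebra.lift K φ, by
    rintro _ _ ⟨ha, hb⟩
    simpa using hφ _ _ _ _ ha hb⟩

@[simp]
theorem Ulift_Uι {A : Type*} [Ring A] [Algebra K A] (φ : V →ₗ[K] A)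
    (hφ : ∀ (g h : G) (a b : V), a ∈ L.grading g → b ∈ L.grading h →
      φ a * φ b = χ.ε g h • (φ b * φ a) + φ (L.bracket a b) + algebraMap K A (c.ω a b)) (x : V) :
    Ulift φ hφ (Uι L c x) = φ x :=
  (RingQuot.liftAlgHom_mkAlgHom_apply _ _ _ _).trans (TensorAlgebra.lift_ι_apply _ _)

theorem Uenv_hom_ext {A : Type*} [Ring A] [Algebra K A] {F F' : Uenv L c →ₐ[K] A}
    (h : ∀ x, F (Uι L c x) = F' (Uι L c x)) : F = F' := by
  exact RingQuot.ringQuot_ext' K _ _ (TensorAlgebra.hom_ext (LinearMap.ext h))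

theorem Uι_add_mul_Uι_add {f : V →ₗ[K] K} (hf : ∀ g : G, g ≠ 1 → ∀ x ∈ L.grading g, f x = 0)
    {g h : G} {a b : V} (ha : a ∈ L.grading g) (hb : b ∈ L.grading h) :
    (Uι L c a + algebraMap K _ (f a)) * (Uι L c b + algebraMap K _ (f b)) =
      χ.ε g h • ((Uι L c b + algebraMap K _ (f b)) * (Uι L c a + algebraMap K _ (f a))) +
        Uι L c (L.bracket a b) + algebraMap K _ (c.ω a b) := by
  have hεa : χ.ε g h * f a = f a := by
    by_cases hg : g = 1
    · rw [hg, χ.ε_one_left, one_mul]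
    · rw [hf g hg a ha, mul_zero]
  have hεb : χ.ε g h * f b = f b := by
    by_cases hh : h = 1
    · rw [hh, χ.ε_one_right, one_mul]
    · rw [hf h hh b hb, mul_zero]
  simp only [Algebra.algebraMap_eq_smul_one, add_mul, mul_add, smul_mul_assoc, mul_smul_comm,
    one_mul, mul_one, Uι_mul_Uι ha hb]
  linear_combination (norm := module)
    -(hεa • Uι L c b) - hεb • Uι L c a - (f b * hεa) • (1 : Uenv L c)

/-- The homomorphism `U_{ω₁}(L) → U_{ω₂}(L)` shifting the generators by a linear form whose
coboundary is `ω₂ - ω₁`. -/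
noncomputable def Ushift (f : V →ₗ[K] K) (hf : ∀ g : G, g ≠ 1 → ∀ x ∈ L.grading g, f x = 0)
    (hω : ∀ x y, c₂.ω x y - c₁.ω x y = f (L.bracket x y)) : Uenv L c₁ →ₐ[K] Uenv L c₂ :=
  Ulift (Uι L c₂ + Algebra.linearMap K (Uenv L c₂) ∘ₗ f) fun g h a b ha hb => by
    simp only [LinearMap.add_apply, LinearMap.comp_apply, Algebra.linearMap_apply,
      Uι_add_mul_Uι_add hf ha hb, ← hω, map_sub]
    abel

theorem Ushift_Uι (f : V →ₗ[K] K) (hf : ∀ g : G, g ≠ 1 → ∀ x ∈ L.grading g, f x = 0)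
    (hω : ∀ x y, c₂.ω x y - c₁.ω x y = f (L.bracket x y)) (x : V) :
    Ushift f hf hω (Uι L c₁ x) = Uι L c₂ x + algebraMap K _ (f x) :=
  Ulift_Uι _ _ x

theorem Ugrading_one_mem : (1 : Uenv L c) ∈ Ugrading L c 1 :=
  Submodule.subset_span ⟨[], by simp, by simp, by simp⟩

theorem Ugrading_mul_mem {g h : G} {u v : Uenv L c} (hu : u ∈ Ugrading L c g)
    (hv : v ∈ Ugrading L c h) : u * v ∈ Ugrading L c (g * h) := by
  have : Ugrading L c g * Ugrading L c h ≤ Ugrading L c (g * h) := by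
    rw [Ugrading, Ugrading, Submodule.span_mul_span, Submodule.span_le]
    rintro _ ⟨_, ⟨l, h1, rfl, rfl⟩, _, ⟨l', h1', rfl, rfl⟩, rfl⟩
    refine Submodule.subset_span ⟨l ++ l', fun p hp => ?_, by simp, by simp⟩
    exact (List.mem_append.1 hp).elim (h1 p) (h1' p)
  exact this (Submodule.mul_mem_mul hu hv)

theorem Uι_mem_Ugrading {g : G} {x : V} (hx : x ∈ L.grading g) : Uι L c x ∈ Ugrading L c g :=
  Submodule.subset_span ⟨[(g, x)], by simpa using hx, by simp, by simp⟩

theorem Ufil_one_mem (n : ℕ) : (1 : Uenv L c) ∈ Ufil L c n :=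
  Submodule.subset_span ⟨[], by simp, by simp⟩

theorem Ufil_mul_mem {m n : ℕ} {u v : Uenv L c} (hu : u ∈ Ufil L c m)
    (hv : v ∈ Ufil L c n) : u * v ∈ Ufil L c (m + n) := by
  have : Ufil L c m * Ufil L c n ≤ Ufil L c (m + n) := by
    rw [Ufil, Ufil, Submodule.span_mul_span, Submodule.span_le]
    rintro _ ⟨_, ⟨l, h1, rfl⟩, _, ⟨l', h1', rfl⟩, rfl⟩
    exact Submodule.subset_span ⟨l ++ l', by simp; omega, by simp⟩
  exact this (Submodule.mul_mem_mul hu hv)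

theorem Ufil_mono {m n : ℕ} (h : m ≤ n) : Ufil L c m ≤ Ufil L c n :=
  Submodule.span_mono fun _ ⟨l, hl, hu⟩ => ⟨l, hl.trans h, hu⟩

theorem Uι_mem_Ufil (x : V) : Uι L c x ∈ Ufil L c 1 :=
  Submodule.subset_span ⟨[x], by simp, by simp⟩

theorem Ufil_zero : Ufil L c 0 = 1 := by
  rw [Ufil, Submodule.one_eq_span]
  congr 1
  ext u
  simp

theorem Ushift_map_Ufil_le (f : V →ₗ[K] K)
    (hf : ∀ g : G, g ≠ 1 → ∀ x ∈ L.grading g, f x = 0)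
    (hω : ∀ x y, c₂.ω x y - c₁.ω x y = f (L.bracket x y)) (n : ℕ) :
    (Ufil L c₁ n).map (Ushift f hf hω).toLinearMap ≤ Ufil L c₂ n := by
  rw [Ufil, Submodule.map_span_le]
  rintro _ ⟨l, hl, rfl⟩
  refine Ufil_mono hl ?_
  clear hl
  induction l with
  | nil => simpa using Ufil_one_mem 0
  | cons x l ih =>
    have h1 : Uι L c₂ x + algebraMap K _ (f x) ∈ Ufil L c₂ 1 := by
      rw [Algebra.algebraMap_eq_smul_one]
      exact add_mem (Uι_mem_Ufil x) (Submodule.smul_mem _ _ (Ufil_one_mem 1))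
    have := Ufil_mul_mem h1 ih
    rw [add_comm] at this
    simpa [Ushift_Uι] using this

theorem Ushift_map_Ugrading_le (f : V →ₗ[K] K)
    (hf : ∀ g : G, g ≠ 1 → ∀ x ∈ L.grading g, f x = 0)
    (hω : ∀ x y, c₂.ω x y - c₁.ω x y = f (L.bracket x y)) (g : G) :
    (Ugrading L c₁ g).map (Ushift f hf hω).toLinearMap ≤ Ugrading L c₂ g := by
  rw [Ugrading, Submodule.map_span_le]
  rintro _ ⟨l, hl, rfl, rfl⟩
  induction l with
  | nil => simpa using Ugrading_one_mem
  | cons p l ih =>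
    have hp : p.2 ∈ L.grading p.1 := hl p (by simp)
    have h1 : Uι L c₂ p.2 + algebraMap K _ (f p.2) ∈ Ugrading L c₂ p.1 := by
      refine add_mem (Uι_mem_Ugrading hp) ?_
      rw [Algebra.algebraMap_eq_smul_one]
      by_cases h : p.1 = 1
      · rw [h]
        exact Submodule.smul_mem _ _ Ugrading_one_mem
      · rw [hf _ h _ hp, zero_smul]
        exact zero_mem _
    have := Ugrading_mul_mem h1 (ih fun q hq => hl q (by simp [hq]))
    simpa [Ushift_Uι] using this

theorem Ushift_comp_Ushift (f : V →ₗ[K] K)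
    (hf : ∀ g : G, g ≠ 1 → ∀ x ∈ L.grading g, f x = 0)
    (hω : ∀ x y, c₂.ω x y - c₁.ω x y = f (L.bracket x y)) (f' : V →ₗ[K] K)
    (hf' : ∀ g : G, g ≠ 1 → ∀ x ∈ L.grading g, f' x = 0)
    (hω' : ∀ x y, c₁.ω x y - c₂.ω x y = f' (L.bracket x y)) (h : f' + f = 0) :
    (Ushift f' hf' hω').comp (Ushift f hf hω) = AlgHom.id K _ := by
  refine Uenv_hom_ext fun x => ?_
  rw [AlgHom.comp_apply, Ushift_Uι, map_add, Ushift_Uι, AlgHom.commutes, AlgHom.id_apply,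
    add_assoc, ← map_add, ← LinearMap.add_apply, h, LinearMap.zero_apply, map_zero, add_zero]

/-- The isomorphism `U_{ω₁}(L) ≃ U_{ω₂}(L)` given by a linear form whose coboundary is
`ω₁ - ω₂`. -/
theorem exists_equiv_of_coboundary (f : V →ₗ[K] K)
    (hf : ∀ g : G, g ≠ 1 → ∀ x ∈ L.grading g, f x = 0)
    (hω : ∀ x y, c₁.ω x y - c₂.ω x y = f (L.bracket x y)) :
    ∃ Ψ : Uenv L c₁ ≃ₐ[K] Uenv L c₂,
      (∀ n : ℕ, Submodule.map Ψ.toLinearMap (Ufil L c₁ n) = Ufil L c₂ n) ∧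
      (∀ g : G, Submodule.map Ψ.toLinearMap (Ugrading L c₁ g) = Ugrading L c₂ g) ∧
      (∀ x : V, Ψ (Uι L c₁ x) - Uι L c₂ x ∈ Ufil L c₂ 0) := by
  have hf' : ∀ g : G, g ≠ 1 → ∀ x ∈ L.grading g, (-f) x = 0 := fun g hg x hx => by
    simp [hf g hg x hx]
  have hω' : ∀ x y, c₂.ω x y - c₁.ω x y = (-f) (L.bracket x y) := fun x y => by
    simp [← hω]
  let Ψ : Uenv L c₁ ≃ₐ[K] Uenv L c₂ := AlgEquiv.ofAlgHom (Ushift (-f) hf' hω') (Ushift f hf hω)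
    (Ushift_comp_Ushift _ _ _ _ _ _ (by simp)) (Ushift_comp_Ushift _ _ _ _ _ _ (by simp))
  have key : ∀ (p : Submodule K (Uenv L c₁)) (q : Submodule K (Uenv L c₂)),
      p.map (Ushift (-f) hf' hω').toLinearMap ≤ q → q.map (Ushift f hf hω).toLinearMap ≤ p →
      p.map Ψ.toLinearMap = q := fun p q h1 h2 =>
    le_antisymm h1 fun u hu => ⟨Ψ.symm u, h2 ⟨u, hu, rfl⟩, Ψ.apply_symm_apply u⟩
  refine ⟨Ψ, fun n => key _ _ (Ushift_map_Ufil_le _ _ _ n) (Ushift_map_Ufil_le _ _ _ n),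
    fun g => key _ _ (Ushift_map_Ugrading_le _ _ _ g) (Ushift_map_Ugrading_le _ _ _ g),
    fun x => ?_⟩
  have : Ψ (Uι L c₁ x) = Uι L c₂ x + algebraMap K _ ((-f) x) := Ushift_Uι _ _ _ x
  rw [this, add_sub_cancel_left, Algebra.algebraMap_eq_smul_one]
  exact Submodule.smul_mem _ _ (Ufil_one_mem 0)

theorem ColorLieAlgebra.grading_induction (L : ColorLieAlgebra χ V) {p : V → Prop}
    (h0 : p 0) (hadd : ∀ x y, p x → p y → p (x + y))
    (hmem : ∀ g, ∀ x ∈ L.grading g, p x) (x : V) : p x := by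
  have hx : x ∈ ⨆ g, L.grading g := L.decomp.submodule_iSup_eq_top ▸ Submodule.mem_top
  exact Submodule.iSup_induction L.grading (motive := p) hx hmem h0 hadd

theorem ColorLieAlgebra.exists_linearMap (L : ColorLieAlgebra χ V) {A : Type*} [AddCommGroup A]
    [Module K A] (φ : G → V →ₗ[K] A) :
    ∃ F : V →ₗ[K] A, ∀ g, ∀ x ∈ L.grading g, F x = φ g x := by
  let e : DirectSum G (fun g => L.grading g) ≃ₗ[K] V :=
    LinearEquiv.ofBijective (DirectSum.coeLinearMap L.grading) L.decomp
  refine ⟨DirectSum.toModule K G A (fun g => φ g ∘ₗ (L.grading g).subtype) ∘ₗ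
    e.symm.toLinearMap, fun g x hx => ?_⟩
  have : e.symm x = DirectSum.lof K G (fun g => L.grading g) g ⟨x, hx⟩ := by
    rw [LinearEquiv.symm_apply_eq]
    exact (DirectSum.coeLinearMap_lof L.grading g ⟨x, hx⟩).symm
  simp [this]

/-- The coaction of `G` on `U_ω(L)` encoding the grading. -/
theorem exists_coaction (L : ColorLieAlgebra χ V) (c : ColorCocycle L) :
    ∃ Δ : Uenv L c →ₐ[K] MonoidAlgebra (Uenv L c) G,
      ∀ g, ∀ u ∈ Ugrading L c g, Δ u = MonoidAlgebra.single g u := by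
  obtain ⟨φ, hφ⟩ := L.exists_linearMap (A := MonoidAlgebra (Uenv L c) G)
    (fun g => MonoidAlgebra.lsingle g ∘ₗ Uι L c)
  simp only [LinearMap.comp_apply, MonoidAlgebra.lsingle_apply] at hφ
  let Δ : Uenv L c →ₐ[K] MonoidAlgebra (Uenv L c) G := Ulift φ fun g h a b ha hb => by
    rw [hφ g a ha, hφ h b hb, hφ _ _ (L.bracket_grade g h a ha b hb),
      MonoidAlgebra.single_mul_single, MonoidAlgebra.single_mul_single, Uι_mul_Uι ha hb,
      MonoidAlgebra.single_add, MonoidAlgebra.single_add, MonoidAlgebra.smul_single, mul_comm h g]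
    congr 1
    by_cases hgh : g * h = 1
    · rw [hgh]
      rfl
    · rw [c.degree_zero g h hgh a ha b hb]
      simp
  refine ⟨Δ, fun g u hu => ?_⟩
  suffices h : Ugrading L c g ≤ LinearMap.eqLocus Δ.toLinearMap
      (MonoidAlgebra.lsingle g : Uenv L c →ₗ[K] _) from h hu
  clear hu
  rw [Ugrading, Submodule.span_le]
  rintro _ ⟨l, hl, rfl, rfl⟩
  change Δ _ = MonoidAlgebra.single _ _
  induction l with
  | nil => simp [MonoidAlgebra.one_def]
  | cons p l ih =>
    simp only [List.map_cons, List.prod_cons, map_mul]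
    rw [ih fun q hq => hl q (by simp [hq]), show Δ (Uι L c p.2) = φ p.2 from Ulift_Uι _ _ _,
      hφ _ _ (hl p (by simp)), MonoidAlgebra.single_mul_single]

/-- Scalars of degree different from `1` vanish. -/
theorem eq_zero_of_algebraMap_mem_Ugrading [Nontrivial (Uenv L c)] {g : G} (hg : g ≠ 1) {r : K}
    (hr : algebraMap K (Uenv L c) r ∈ Ugrading L c g) : r = 0 := by
  obtain ⟨Δ, hΔ⟩ := exists_coaction L c
  have h1 := hΔ g _ hr
  have h2 : algebraMap K (Uenv L c) r ∈ Ugrading L c 1 := by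
    rw [Algebra.algebraMap_eq_smul_one]
    exact Submodule.smul_mem _ _ Ugrading_one_mem
  rw [hΔ 1 _ h2] at h1
  by_contra hr0
  have h3 : algebraMap K (Uenv L c) r ≠ 0 := by simpa using hr0
  exact hg ((MonoidAlgebra.single_left_inj h3).1 h1).symm

theorem exists_coboundary_of_equiv [CharZero K] (Ψ : Uenv L c₁ ≃ₐ[K] Uenv L c₂)
    (hg : ∀ g : G, Submodule.map Ψ.toLinearMap (Ugrading L c₁ g) = Ugrading L c₂ g)
    (hι : ∀ x : V, Ψ (Uι L c₁ x) - Uι L c₂ x ∈ Ufil L c₂ 0) :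
    ∃ f : V →ₗ[K] K, (∀ g : G, g ≠ 1 → ∀ x ∈ L.grading g, f x = 0) ∧
      ∀ x y : V, c₁.ω x y - c₂.ω x y = f (L.bracket x y) := by
  have := Uenv_nontrivial L c₂
  obtain ⟨k, hk⟩ := (Algebra.linearMap K (Uenv L c₂)).exists_leftInverse_of_injective
    (LinearMap.ker_eq_bot.2 (algebraMap K (Uenv L c₂)).injective)
  let f : V →ₗ[K] K := k ∘ₗ (Ψ.toLinearMap ∘ₗ Uι L c₁ - Uι L c₂)
  have hf : ∀ x, Ψ (Uι L c₁ x) = Uι L c₂ x + algebraMap K _ (f x) := fun x => by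
    have h := hι x
    rw [Ufil_zero] at h
    obtain ⟨r, hr⟩ := Submodule.mem_one.1 h
    have : f x = r := by
      change k (Ψ (Uι L c₁ x) - Uι L c₂ x) = r
      rw [← hr]
      exact LinearMap.congr_fun hk r
    rw [this, hr, add_sub_cancel]
  have hf0 : ∀ g : G, g ≠ 1 → ∀ x ∈ L.grading g, f x = 0 := fun g hg1 x hx => by
    refine eq_zero_of_algebraMap_mem_Ugrading (L := L) (c := c₂) hg1 ?_
    rw [← add_sub_cancel_left (Uι L c₂ x) (algebraMap K _ (f x)), ← hf]
    refine sub_mem ?_ (Uι_mem_Ugrading hx)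
    rw [← hg]
    exact ⟨_, Uι_mem_Ugrading hx, rfl⟩
  refine ⟨-f, fun g hg1 x hx => by simp [hf0 g hg1 x hx], fun x y => ?_⟩
  refine L.grading_induction (p := fun x => c₁.ω x y - c₂.ω x y = (-f) (L.bracket x y))
    (by simp) (fun x x' h h' => ?_) (fun g x hx => ?_) x
  · simp only [map_add, LinearMap.add_apply] at h h' ⊢
    rw [← h, ← h']; ring
  refine L.grading_induction (p := fun y => c₁.ω x y - c₂.ω x y = (-f) (L.bracket x y))
    (by simp) (fun y y' h h' => ?_) (fun h y hy => ?_) y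
  · simp only [map_add] at h h' ⊢
    rw [← h, ← h']; ring
  apply (algebraMap K (Uenv L c₂)).injective
  have hrel := congrArg Ψ (Uι_mul_Uι (c := c₁) hx hy)
  simp only [map_add, map_mul, map_smul, AlgEquiv.commutes, hf, Uι_add_mul_Uι_add hf0 hx hy]
    at hrel
  rw [map_sub, LinearMap.neg_apply, map_neg]
  linear_combination (norm := module) -hrel

end Hom

/-- two generalized enveloping algebras `(U_{ω₁}(L), φ_{ω₁})` and
`(U_{ω₂}(L), φ_{ω₂})` of the same color Lie algebra `L` are isomorphic as `ℤ`-filtered,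
`G`-graded algebras compatibly with the structure maps `φ` (equivalently, the isomorphism
carries `i_{ω₁}(x)` to `i_{ω₂}(x)` modulo scalars) if and only if `ω₁` and `ω₂` are
cohomologous, i.e. `ω₁ - ω₂` is the coboundary of a graded linear form of degree zero. -/
theorem Uomega_iso_iff_cohomologous [CharZero K]
    (L : ColorLieAlgebra χ V) (c₁ c₂ : ColorCocycle L) :
    (∃ Ψ : Uenv L c₁ ≃ₐ[K] Uenv L c₂,
      (∀ n : ℕ, Submodule.map Ψ.toLinearMap (Ufil L c₁ n) = Ufil L c₂ n) ∧
      (∀ g : G, Submodule.map Ψ.toLinearMap (Ugrading L c₁ g) = Ugrading L c₂ g) ∧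
      (∀ x : V, Ψ (Uι L c₁ x) - Uι L c₂ x ∈ Ufil L c₂ 0)) ↔
    (∃ f : V →ₗ[K] K, (∀ g : G, g ≠ 1 → ∀ x ∈ L.grading g, f x = 0) ∧
      ∀ x y : V, c₁.ω x y - c₂.ω x y = f (L.bracket x y)) := by
  exact ⟨fun ⟨Ψ, _, hg, hι⟩ => exists_coboundary_of_equiv Ψ hg hι,
    fun ⟨f, hf, hω⟩ => exists_equiv_of_coboundary f hf hω⟩
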